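/- Let u, B_R and F be as in the context. Then there exists a constant C (depending only on the L² norms of u and of its gradient) such that, for R small enough (namely when λ₁(B_R) ≥ 1 and 4λ_a/λ₁(B_R) ≤ 1/2), for every v ∈ F one has J(v) ≥ (1/2)∫_{B_R}|∇v|² − C. -/

import Mathlib

open MeasureTheory Filter Metric Set
open scoped RealInnerProductSpace ENNReal Topology NNReal

noncomputable section

abbrev Euc (d : ℕ) := EuclideanSpace ℝ (Fin d)

variable {d : ℕ}

/-- Real-valued Lebesgue volume of a set. -/
def mvol (s : Set (Euc d)) : ℝ := (volume s).toReal

/-- Smooth scalar test function compactly supported in `Ω`. -/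
def TestFun (Ω : Set (Euc d)) (φ : Euc d → ℝ) : Prop :=
  ContDiff ℝ (⊤ : ℕ∞) φ ∧ HasCompactSupport φ ∧ tsupport φ ⊆ Ω

/-- Smooth vector field compactly supported in `Ω`. -/
def VecTestFun (Ω : Set (Euc d)) (Φ : Euc d → Euc d) : Prop :=
  ContDiff ℝ (⊤ : ℕ∞) Φ ∧ HasCompactSupport Φ ∧ tsupport Φ ⊆ Ω

/-- Membership in `H¹₀(Ω)`, encoded through `L²` integrability of the function and of its
(a.e. defined) gradient, together with approximation in the `H¹` norm by smooth functions
compactly supported in `Ω`. -/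
def MemH10 (Ω : Set (Euc d)) (v : Euc d → ℝ) : Prop :=
  MemLp v 2 (volume : Measure (Euc d)) ∧
  MemLp (fun x => gradient v x) 2 (volume : Measure (Euc d)) ∧
  ∃ φ : ℕ → Euc d → ℝ, (∀ n, TestFun Ω (φ n)) ∧
    Tendsto (fun n => ∫ x, ((v x - φ n x) ^ 2 + ‖gradient v x - gradient (φ n) x‖ ^ 2))
      atTop (nhds 0)

/-- First Dirichlet eigenvalue of `Ω`, via the Rayleigh quotient variational characterization. -/
def lam1 (Ω : Set (Euc d)) : ℝ :=
  sInf {t : ℝ | ∃ v : Euc d → ℝ, MemH10 Ω v ∧ (∫ x, (v x) ^ 2) = 1 ∧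
    t = ∫ x, ‖gradient v x‖ ^ 2}

/-- `u` is a normalized first Dirichlet eigenfunction of `Ω`. -/
def IsFirstEigenfun (Ω : Set (Euc d)) (u : Euc d → ℝ) : Prop :=
  MemH10 Ω u ∧ (∫ x, (u x) ^ 2) = 1 ∧ (∫ x, ‖gradient u x‖ ^ 2) = lam1 Ω ∧
  ∀ φ : Euc d → ℝ, TestFun Ω φ →
    (∫ x, ⟪gradient u x, gradient φ x⟫) = lam1 Ω * ∫ x, u x * φ x

/-- `Ω` solves the shape optimization problem: it minimizes `λ₁` among open subsets of `D` of
measure `a`. -/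
structure IsOptimalShape (D : Set (Euc d)) (a : ℝ) (Ω : Set (Euc d)) : Prop where
  isOpen : IsOpen Ω
  subset : Ω ⊆ D
  meas : mvol Ω = a
  minim : ∀ Ω' : Set (Euc d), IsOpen Ω' → Ω' ⊆ D → mvol Ω' = a → lam1 Ω ≤ lam1 Ω'

/-- `u` is locally Lipschitz continuous in `s`. -/
def LocLipOn (s : Set (Euc d)) (u : Euc d → ℝ) : Prop :=
  ∀ x ∈ s, ∃ t, t ∈ 𝓝 x ∧ t ⊆ s ∧ ∃ K : ℝ≥0, LipschitzOnWith K u t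

/-- Divergence of a vector field. -/
def divg (Φ : Euc d → Euc d) (x : Euc d) : ℝ :=
  ∑ i, fderiv ℝ Φ x (EuclideanSpace.single i 1) i

/-- `Ω` has locally finite perimeter in `D` (its characteristic function has locally bounded
variation in `D`). -/
def HasLocFinPerimeterIn (D Ω : Set (Euc d)) : Prop :=
  ∀ K : Set (Euc d), IsCompact K → K ⊆ D → ∃ C : ℝ,
    ∀ Φ : Euc d → Euc d, VecTestFun K Φ → (∀ x, ‖Φ x‖ ≤ 1) →
      (∫ x in Ω, divg Φ x) ≤ C

/-- The reduced boundary of `Ω`: points where `Ω` blows up to a half space, in the sense that the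
symmetric difference with a half space is of vanishing density. -/
def reducedBoundary (Ω : Set (Euc d)) : Set (Euc d) :=
  {x | ∃ ν : Euc d, ‖ν‖ = 1 ∧
    Tendsto (fun r : ℝ =>
        volume (symmDiff (Ω ∩ ball x r) ({y | ⟪y - x, ν⟫ ≤ 0} ∩ ball x r)) /
          ENNReal.ofReal (r ^ d))
      (𝓝[>] 0) (𝓝 0)}

/-- `S` is an analytic hypersurface in `D`: near each of its points in `D` it is the zero set of
an analytic function with nonvanishing gradient. -/
def IsAnalyticHypersurfaceIn (D S : Set (Euc d)) : Prop :=
  ∀ x ∈ S ∩ D, ∃ U : Set (Euc d), IsOpen U ∧ x ∈ U ∧ U ⊆ D ∧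
    ∃ f : Euc d → ℝ, AnalyticOn ℝ f U ∧ (∀ y ∈ U, fderiv ℝ f y ≠ 0) ∧
      S ∩ U = {y ∈ U | f y = 0}

/-- The functional `J(v) = ∫ |∇v|² - λ ∫ v²`. -/
def Jfun (lam : ℝ) (v : Euc d → ℝ) : ℝ :=
  (∫ x, ‖gradient v x‖ ^ 2) - lam * ∫ x, (v x) ^ 2

/-- `Ω_v = {x ∈ D : v(x) ≠ 0}`. -/
def Om (D : Set (Euc d)) (v : Euc d → ℝ) : Set (Euc d) := {x ∈ D | v x ≠ 0}

/-- The optimal value `λ_a` of `λ₁` among open subsets of `D` of measure `a`. -/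
def lamOpt (D : Set (Euc d)) (a : ℝ) : ℝ :=
  sInf {t : ℝ | ∃ Ω : Set (Euc d), IsOpen Ω ∧ Ω ⊆ D ∧ mvol Ω = a ∧ t = lam1 Ω}

/-- `u` minimizes `J` among functions of `H¹₀(D)` with `|Ω_w| ≤ a`. -/
def IsJMinimizer (D : Set (Euc d)) (a lam : ℝ) (u : Euc d → ℝ) : Prop :=
  MemH10 D u ∧ mvol (Om D u) ≤ a ∧
  ∀ w : Euc d → ℝ, MemH10 D w → mvol (Om D w) ≤ a → Jfun lam u ≤ Jfun lam w

/-- The class `F` of perturbations of `u` supported in `B`. -/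
def Fcal (D B : Set (Euc d)) (u v : Euc d → ℝ) : Prop :=
  MemH10 D v ∧ MemH10 B (fun x => u x - v x)

/-- The set of penalization constants `μ₋` admissible for `h` (inward perturbations). -/
def Mminus (D : Set (Euc d)) (a lam : ℝ) (u : Euc d → ℝ) (B : Set (Euc d)) (h : ℝ) :
    Set ℝ :=
  {μ : ℝ | 0 ≤ μ ∧ ∀ v : Euc d → ℝ, Fcal D B u v →
    a - h ≤ mvol (Om D v) → mvol (Om D v) ≤ a →
    Jfun lam u + μ * mvol (Om D u) ≤ Jfun lam v + μ * mvol (Om D v)}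

/-- The set of penalization constants `μ₊` admissible for `h` (outward perturbations). -/
def Mplus (D : Set (Euc d)) (a lam : ℝ) (u : Euc d → ℝ) (B : Set (Euc d)) (h : ℝ) :
    Set ℝ :=
  {μ : ℝ | 0 ≤ μ ∧ ∀ v : Euc d → ℝ, Fcal D B u v →
    a ≤ mvol (Om D v) → mvol (Om D v) ≤ a + h →
    Jfun lam u + μ * mvol (Om D u) ≤ Jfun lam v + μ * mvol (Om D v)}

/-- `μ₋(h)`: the biggest admissible inward penalization constant. -/
def muMinus (D : Set (Euc d)) (a lam : ℝ) (u : Euc d → ℝ) (B : Set (Euc d)) (h : ℝ) : ℝ :=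
  sSup (Mminus D a lam u B h)

/-- `μ₊(h)`: the smallest admissible outward penalization constant. -/
def muPlus (D : Set (Euc d)) (a lam : ℝ) (u : Euc d → ℝ) (B : Set (Euc d)) (h : ℝ) : ℝ :=
  sInf (Mplus D a lam u B h)

/-- Average of `u` on the sphere `∂B(x,r)`, with respect to the `(d-1)`-Hausdorff measure. -/
def sphAvg (u : Euc d → ℝ) (x : Euc d) (r : ℝ) : ℝ :=
  (∫ y in sphere x r, u y ∂(μH[(d : ℝ) - 1])) / ((μH[(d : ℝ) - 1]) (sphere x r)).toReal

theorem aux_cs {h k : Euc d → ℝ} (hh : MemLp h 2 volume) (hk : MemLp k 2 volume) :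
    (∫ x, h x * k x) ^ 2 ≤ (∫ x, h x ^ 2) * ∫ x, k x ^ 2 := by
  have i1 := hh.integrable_sq
  have i2 := hk.integrable_sq
  have i3 : Integrable (fun x => h x * k x) volume := hh.integrable_mul hk
  have key : ∀ t : ℝ, 0 ≤ (∫ x, k x ^ 2) * (t * t) + (2 * ∫ x, h x * k x) * t
      + ∫ x, h x ^ 2 := by
    intro t
    have e : ∫ x, (h x + t * k x) ^ 2 = (∫ x, k x ^ 2) * (t * t) + (2 * ∫ x, h x * k x) * t
      + ∫ x, h x ^ 2 := by
      have : (fun x => (h x + t * k x) ^ 2) =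
          fun x => ((t * t) * k x ^ 2 + (2 * t) * (h x * k x)) + h x ^ 2 := by
        funext x; ring
      have i4 : Integrable (fun x => (t * t) * k x ^ 2 + (2 * t) * (h x * k x)) volume :=
        (i2.const_mul _).add (i3.const_mul _)
      rw [this, integral_add i4 i1,
        integral_add (i2.const_mul _) (i3.const_mul _), integral_const_mul, integral_const_mul]
      ring
    rw [← e]
    exact integral_nonneg (fun x => sq_nonneg _)
  have := discrim_le_zero key
  rw [discrim] at this
  nlinarith

theorem aux_tendsto {h : ℕ → Euc d → ℝ} {k : Euc d → ℝ} (hh : ∀ n, MemLp (h n) 2 volume)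
    (hk : MemLp k 2 volume) (ht : Tendsto (fun n => ∫ x, h n x ^ 2) atTop (nhds 0)) :
    Tendsto (fun n => ∫ x, h n x * k x) atTop (nhds 0) := by
  have h1 : Tendsto (fun n => (∫ x, h n x * k x) ^ 2) atTop (nhds 0) := by
    refine squeeze_zero (fun n => sq_nonneg _) (fun n => aux_cs (hh n) hk) ?_
    simpa using ht.mul_const (∫ x, k x ^ 2)
  have h2 := h1.sqrt
  simp only [Real.sqrt_sq_eq_abs, Real.sqrt_zero] at h2
  exact (tendsto_zero_iff_abs_tendsto_zero _).2 h2

theorem aux_grad_cont {φ : Euc d → ℝ} (h : ContDiff ℝ (⊤ : ℕ∞) φ) :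
    Continuous (fun x => gradient φ x) :=
  (InnerProductSpace.toDual ℝ (Euc d)).symm.continuous.comp (h.continuous_fderiv (by simp))

theorem aux_grad_supp {φ : Euc d → ℝ} (h : HasCompactSupport φ) :
    HasCompactSupport (fun x => gradient φ x) :=
  (h.fderiv ℝ).comp_left (g := (InnerProductSpace.toDual ℝ (Euc d)).symm) (map_zero _)

theorem aux_weak {Ω : Set (Euc d)} {v : Euc d → ℝ} (hv : MemH10 Ω v) {g : Euc d → ℝ}
    (hg : ContDiff ℝ (⊤ : ℕ∞) g) (hgs : HasCompactSupport g) (e : Euc d) :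
    (∫ x, ⟪gradient v x, e⟫ * g x) + ∫ x, v x * fderiv ℝ g x e = 0 := by
  obtain ⟨hv1, hv2, φ, hφ, ht⟩ := hv
  have hgL : MemLp g 2 volume := hg.continuous.memLp_of_hasCompactSupport hgs
  have hg'L : MemLp (fun x => fderiv ℝ g x e) 2 volume :=
    ((hg.continuous_fderiv (by simp)).clm_apply continuous_const).memLp_of_hasCompactSupport
      (hgs.fderiv_apply ℝ e)
  have hφL : ∀ n, MemLp (φ n) 2 volume := fun n =>
    (hφ n).1.continuous.memLp_of_hasCompactSupport (hφ n).2.1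
  have hφ'L : ∀ n, MemLp (fun x => gradient (φ n) x) 2 volume := fun n =>
    (aux_grad_cont (hφ n).1).memLp_of_hasCompactSupport (aux_grad_supp (hφ n).2.1)
  have hd : ∀ n, MemLp (fun x => v x - φ n x) 2 volume := fun n => hv1.sub (hφL n)
  have hd' : ∀ n, MemLp (fun x => gradient v x - gradient (φ n) x) 2 volume :=
    fun n => hv2.sub (hφ'L n)
  have hde : ∀ n, MemLp (fun x => ⟪gradient v x - gradient (φ n) x, e⟫) 2 volume :=
    fun n => (hd' n).inner_const e
  have is1 := fun n => (hd n).integrable_sq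
  have is2 : ∀ n, Integrable (fun x => ‖gradient v x - gradient (φ n) x‖ ^ 2) volume :=
    fun n => (hd' n).norm.integrable_sq
  have t1 : Tendsto (fun n => ∫ x, (v x - φ n x) ^ 2) atTop (nhds 0) := by
    refine squeeze_zero (fun n => integral_nonneg (fun x => sq_nonneg _)) (fun n => ?_) ht
    refine integral_mono (is1 n) ((is1 n).add (is2 n)) (fun x => ?_)
    simp only [Pi.add_apply]
    nlinarith [sq_nonneg ‖gradient v x - gradient (φ n) x‖]
  have t2 : Tendsto (fun n => ∫ x, ⟪gradient v x - gradient (φ n) x, e⟫ ^ 2) atTop (nhds 0) := by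
    have ht' := ht.const_mul (‖e‖ ^ 2)
    rw [mul_zero] at ht'
    refine squeeze_zero (fun n => integral_nonneg (fun x => sq_nonneg _)) (fun n => ?_) ht'
    rw [← integral_const_mul]
    refine integral_mono (hde n).integrable_sq (((is1 n).add (is2 n)).const_mul _) (fun x => ?_)
    simp only [Pi.add_apply]
    have h1 := abs_real_inner_le_norm (gradient v x - gradient (φ n) x) e
    have h2 := sq_le_sq' (abs_le.1 h1).1 (abs_le.1 h1).2
    have h3 := mul_nonneg (sq_nonneg ‖e‖) (sq_nonneg (v x - φ n x))
    nlinarith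
  have T := (aux_tendsto hde hgL t2).add (aux_tendsto hd hg'L t1)
  rw [add_zero] at T
  refine tendsto_nhds_unique (tendsto_const_nhds (f := (atTop : Filter ℕ))) (T.congr fun n => ?_)
  have a1 : Integrable (fun x => ⟪gradient v x, e⟫ * g x) volume :=
    (hv2.inner_const e).integrable_mul hgL
  have a2 : Integrable (fun x => ⟪gradient (φ n) x, e⟫ * g x) volume :=
    ((hφ'L n).inner_const e).integrable_mul hgL
  have a3 : Integrable (fun x => v x * fderiv ℝ g x e) volume := hv1.integrable_mul hg'L
  have a4 : Integrable (fun x => φ n x * fderiv ℝ g x e) volume := (hφL n).integrable_mul hg'L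
  have a5 : Integrable (fun x => φ n x * g x) volume := (hφL n).integrable_mul hgL
  have a2' := a2
  simp only [inner_gradient_left] at a2'
  have ibp := integral_mul_fderiv_eq_neg_fderiv_mul_of_integrable a2' a4 a5
    (fun x _ => ((hφ n).1.differentiable (by simp)) x) (fun x _ => (hg.differentiable (by simp)) x)
  simp only [inner_sub_left, sub_mul]
  rw [integral_sub a1 a2, integral_sub a3 a4, ibp]
  simp only [inner_gradient_left]
  ring

theorem aux_grad_sub {D B : Set (Euc d)} {u v : Euc d → ℝ} (hu : MemH10 D u) (hv : MemH10 D v)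
    (hw : MemH10 B (fun x => u x - v x)) :
    ∀ᵐ x, gradient (fun x => u x - v x) x = gradient u x - gradient v x := by
  have key : ∀ e : Euc d, ∀ᵐ x,
      ⟪gradient u x, e⟫ - ⟪gradient v x, e⟫ - ⟪gradient (fun x => u x - v x) x, e⟫ = 0 := by
    intro e
    have m1 := hu.2.1.inner_const (𝕜 := ℝ) e
    have m2 := hv.2.1.inner_const (𝕜 := ℝ) e
    have m3 := hw.2.1.inner_const (𝕜 := ℝ) e
    refine ae_eq_zero_of_integral_contDiff_smul_eq_zero
      (((m1.sub m2).sub m3).locallyIntegrable (by norm_num)) (fun g hg hgs => ?_)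
    have hgL : MemLp g 2 volume := hg.continuous.memLp_of_hasCompactSupport hgs
    have hg'L : MemLp (fun x => fderiv ℝ g x e) 2 volume :=
      ((hg.continuous_fderiv (by simp)).clm_apply continuous_const).memLp_of_hasCompactSupport
        (hgs.fderiv_apply ℝ e)
    have w1 := aux_weak hu hg hgs e
    have w2 := aux_weak hv hg hgs e
    have w3 := aux_weak hw hg hgs e
    have b1 : Integrable (fun x => ⟪gradient u x, e⟫ * g x) volume := m1.integrable_mul hgL
    have b2 : Integrable (fun x => ⟪gradient v x, e⟫ * g x) volume := m2.integrable_mul hgL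
    have b3 : Integrable (fun x => ⟪gradient (fun x => u x - v x) x, e⟫ * g x) volume :=
      m3.integrable_mul hgL
    have c1 : Integrable (fun x => u x * fderiv ℝ g x e) volume := hu.1.integrable_mul hg'L
    have c2 : Integrable (fun x => v x * fderiv ℝ g x e) volume := hv.1.integrable_mul hg'L
    have w3' : ∫ x, (u x - v x) * fderiv ℝ g x e =
        (∫ x, u x * fderiv ℝ g x e) - ∫ x, v x * fderiv ℝ g x e := by
      simp only [sub_mul]
      exact integral_sub c1 c2
    have E : ∫ x, g x • (⟪gradient u x, e⟫ - ⟪gradient v x, e⟫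
        - ⟪gradient (fun x => u x - v x) x, e⟫) = (∫ x, ⟪gradient u x, e⟫ * g x)
        - (∫ x, ⟪gradient v x, e⟫ * g x)
        - ∫ x, ⟪gradient (fun x => u x - v x) x, e⟫ * g x := by
      have b4 : Integrable (fun x => ⟪gradient u x, e⟫ * g x - ⟪gradient v x, e⟫ * g x) volume :=
        b1.sub b2
      rw [← integral_sub b1 b2, ← integral_sub b4 b3]
      congr 1
      funext x
      simp only [smul_eq_mul]
      ring
    refine E.trans ?_
    linarith
  have key' : ∀ᵐ x, ∀ i : Fin d, ⟪gradient u x, EuclideanSpace.single i (1 : ℝ)⟫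
      - ⟪gradient v x, EuclideanSpace.single i (1 : ℝ)⟫
      - ⟪gradient (fun x => u x - v x) x, EuclideanSpace.single i (1 : ℝ)⟫ = 0 :=
    ae_all_iff.2 fun i => key _
  filter_upwards [key'] with x hx
  ext i
  have := hx i
  simp only [EuclideanSpace.inner_single_right, conj_trivial, one_mul] at this
  simp only [PiLp.sub_apply]
  linarith

theorem aux_grad_smul (c : ℝ) (v : Euc d → ℝ) (hc : c ≠ 0) (x : Euc d) :
    gradient (fun y => c * v y) x = c • gradient v x := by
  have h : fderiv ℝ (fun y => c * v y) x = c • fderiv ℝ v x := by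
    exact congrFun (fderiv_const_smul_field (𝕜 := ℝ) (f := v) c) x
  rw [gradient, h, gradient]
  simp

theorem aux_memH10_smul {Ω : Set (Euc d)} {v : Euc d → ℝ} (hv : MemH10 Ω v) {c : ℝ}
    (hc : c ≠ 0) : MemH10 Ω (fun y => c * v y) := by
  obtain ⟨h1, h2, φ, hφ, ht⟩ := hv
  refine ⟨h1.const_mul c, ?_, fun n y => c * φ n y, fun n => ⟨?_, ?_, ?_⟩, ?_⟩
  · simp only [aux_grad_smul c v hc]
    exact h2.const_smul c
  · exact contDiff_const.mul (hφ n).1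
  · exact (hφ n).2.1.mul_left
  · exact (tsupport_mul_subset_right).trans (hφ n).2.2
  · have := ht.const_mul (c ^ 2)
    rw [mul_zero] at this
    refine this.congr fun n => ?_
    rw [← integral_const_mul]
    congr 1
    funext x
    rw [aux_grad_smul c v hc, aux_grad_smul c (φ n) hc, ← smul_sub, norm_smul, mul_pow,
      Real.norm_eq_abs, sq_abs]
    ring

theorem aux_poincare {Ω : Set (Euc d)} {w : Euc d → ℝ} (hw : MemH10 Ω w) :
    lam1 Ω * ∫ x, w x ^ 2 ≤ ∫ x, ‖gradient w x‖ ^ 2 := by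
  have hs0 : 0 ≤ ∫ x, w x ^ 2 := integral_nonneg fun x => sq_nonneg _
  rcases hs0.eq_or_lt with h | hs
  · rw [← h, mul_zero]
    exact integral_nonneg fun x => sq_nonneg _
  set s := ∫ x, w x ^ 2 with hsdef
  have hc : (Real.sqrt s)⁻¹ ≠ 0 := by positivity
  have hc2 : ((Real.sqrt s)⁻¹) ^ 2 = s⁻¹ := by rw [inv_pow, Real.sq_sqrt hs0]
  have hle : lam1 Ω ≤ ∫ x, ‖gradient (fun y => (Real.sqrt s)⁻¹ * w y) x‖ ^ 2 := by
    refine csInf_le ⟨0, ?_⟩ ⟨_, aux_memH10_smul hw hc, ?_, rfl⟩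
    · rintro t ⟨v, -, -, rfl⟩
      exact integral_nonneg fun x => sq_nonneg _
    · simp only [mul_pow, hc2]
      rw [integral_const_mul, ← hsdef]
      exact inv_mul_cancel₀ hs.ne'
  simp only [aux_grad_smul _ w hc, norm_smul, mul_pow, Real.norm_eq_abs, sq_abs, hc2] at hle
  rw [integral_const_mul] at hle
  calc lam1 Ω * s ≤ (s⁻¹ * ∫ x, ‖gradient w x‖ ^ 2) * s := by gcongr
    _ = _ := by field_simp

theorem aux_lam1_nonneg (Ω : Set (Euc d)) : 0 ≤ lam1 Ω := by
  refine Real.sInf_nonneg ?_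
  rintro t ⟨v, -, -, rfl⟩
  exact integral_nonneg fun x => sq_nonneg _

theorem aux_lamOpt_nonneg (D : Set (Euc d)) (a : ℝ) : 0 ≤ lamOpt D a := by
  refine Real.sInf_nonneg ?_
  rintro t ⟨Ω, -, -, -, rfl⟩
  exact aux_lam1_nonneg Ω

/-- Coercivity of `J` on `F`: there is a constant `C` (depending only on the
`L²` norms of `u` and of its gradient) such that whenever `R` is small enough — namely
`λ₁(B_R) ≥ 1` and `4λ_a/λ₁(B_R) ≤ 1/2` — every `v ∈ F` satisfies
`J(v) ≥ (1/2)∫_{B_R}|∇v|² - C`. -/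
theorem J_bounded_below_on_F
    {d : ℕ} (D : Set (Euc d)) (a lama : ℝ) (u : Euc d → ℝ)
    (hD : IsOpen D) (hDb : Bornology.IsBounded D) (hDc : IsConnected D)
    (ha : 0 < a) (ha' : a < mvol D)
    (hlam : lama = lamOpt D a) (hu : IsJMinimizer D a lama u) :
    ∃ C : ℝ, ∀ (R : ℝ) (x₀ : Euc d), 0 < R →
      x₀ ∈ frontier (Om D u) ∩ D → ball x₀ R ⊆ D →
      1 ≤ lam1 (ball x₀ R) → 4 * lama / lam1 (ball x₀ R) ≤ 1 / 2 →
      ∀ v : Euc d → ℝ, Fcal D (ball x₀ R) u v →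
        (1 / 2) * (∫ x in ball x₀ R, ‖gradient v x‖ ^ 2) - C ≤ Jfun lama v := by
  have hl0 : 0 ≤ lama := hlam ▸ aux_lamOpt_nonneg D a
  refine ⟨2 * lama * (∫ x, u x ^ 2) + 1 / 2 * ∫ x, ‖gradient u x‖ ^ 2, ?_⟩
  intro R x₀ hR hx hB h1 h2 v hv
  obtain ⟨hv, hw⟩ := hv
  have hu' := hu.1
  have gae := aux_grad_sub hu' hv hw
  have P := aux_poincare hw
  have iu := hu'.1.integrable_sq
  have iv := hv.1.integrable_sq
  have iw := hw.1.integrable_sq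
  have igu : Integrable (fun x => ‖gradient u x‖ ^ 2) volume := hu'.2.1.norm.integrable_sq
  have igv : Integrable (fun x => ‖gradient v x‖ ^ 2) volume := hv.2.1.norm.integrable_sq
  have igw : Integrable (fun x => ‖gradient (fun x => u x - v x) x‖ ^ 2) volume :=
    hw.2.1.norm.integrable_sq
  have I1 : ∫ x, v x ^ 2 ≤ 2 * (∫ x, u x ^ 2) + 2 * ∫ x, (u x - v x) ^ 2 := by
    rw [← integral_const_mul, ← integral_const_mul,
      ← integral_add (iu.const_mul _) (iw.const_mul _)]
    refine integral_mono iv ((iu.const_mul _).add (iw.const_mul _)) fun x => ?_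
    simp only [Pi.add_apply]
    nlinarith [sq_nonneg (2 * u x - v x)]
  have I2 : ∫ x, ‖gradient (fun x => u x - v x) x‖ ^ 2 ≤
      2 * (∫ x, ‖gradient u x‖ ^ 2) + 2 * ∫ x, ‖gradient v x‖ ^ 2 := by
    rw [← integral_const_mul, ← integral_const_mul,
      ← integral_add (igu.const_mul _) (igv.const_mul _)]
    refine integral_mono_ae igw ((igu.const_mul _).add (igv.const_mul _)) ?_
    filter_upwards [gae] with x hx
    simp only [hx, Pi.add_apply]
    have := norm_sub_le (gradient u x) (gradient v x)
    have h0 := norm_nonneg (gradient u x - gradient v x)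
    nlinarith [sq_nonneg (‖gradient u x‖ - ‖gradient v x‖)]
  have I3 : ∫ x in ball x₀ R, ‖gradient v x‖ ^ 2 ≤ ∫ x, ‖gradient v x‖ ^ 2 :=
    setIntegral_le_integral igv (Eventually.of_forall fun x => sq_nonneg _)
  have hL : 0 < lam1 (ball x₀ R) := by linarith
  rw [div_le_iff₀ hL] at h2
  have hW : 0 ≤ ∫ x, (u x - v x) ^ 2 := integral_nonneg fun x => sq_nonneg _
  have I4 := mul_le_mul_of_nonneg_left I1 hl0
  have I5 := mul_le_mul_of_nonneg_right h2 hW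
  unfold Jfun
  linarith

end
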